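/- (Time-weighted H² smoothing for the linear KdV equation.) Let L, T > 0. There exists a constant C > 0 such that for every w ∈ C^∞([0,T]×[0,L]) satisfying w_t + w_x + w_xxx = 0 on (0,T)×(0,L) and w(t,0) = w(t,L) = w_x(t,L) = 0 for all t ∈ [0,T], one has: ∫₀^T t · ( ∫₀^L ( w(t,x)² + w_x(t,x)² + w_xx(t,x)² ) dx ) dt ≤ C ∫₀^L x · w(0,x)² dx. -/

import Mathlib

/-- Partial derivative in the space variable (second argument). -/
noncomputable def pdx (f : ℝ → ℝ → ℝ) : ℝ → ℝ → ℝ := fun t x => deriv (f t) x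

/-- Partial derivative in the time variable (first argument). -/
noncomputable def pdt (f : ℝ → ℝ → ℝ) : ℝ → ℝ → ℝ := fun t x => deriv (fun s => f s x) t

open Set Filter Topology MeasureTheory Function

/-- Integration of a pointwise bound by a linear combination plus an exact derivative. -/
lemma integral_le_combination_add_boundary {L : ℝ} (hL : 0 ≤ L) {a p q r φ φ' : ℝ → ℝ}
    (ha : Continuous a) (hp : Continuous p) (hq : Continuous q) (hr : Continuous r)
    (hφ' : Continuous φ') (hφ : ∀ x, HasDerivAt φ (φ' x) x) (c₁ c₂ c₃ : ℝ)
    (h : ∀ x ∈ Ioo 0 L, a x ≤ c₁ * p x + c₂ * q x + c₃ * r x + φ' x) :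
    ∫ x in (0:ℝ)..L, a x ≤ c₁ * (∫ x in (0:ℝ)..L, p x) + c₂ * (∫ x in (0:ℝ)..L, q x) +
      c₃ * (∫ x in (0:ℝ)..L, r x) + (φ L - φ 0) := by
  have h1 : Continuous fun x => c₁ * p x := by fun_prop
  have h2 : Continuous fun x => c₂ * q x := by fun_prop
  have h3 : Continuous fun x => c₃ * r x := by fun_prop
  have key := intervalIntegral.integral_mono_on_of_le_Ioo (μ := volume) hL
    (ha.intervalIntegrable 0 L)
    ((((h1.add h2).add h3).add hφ').intervalIntegrable 0 L) h
  refine key.trans_eq ?_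
  have e1 := intervalIntegral.integral_add (μ := volume)
    (((h1.add h2).add h3).intervalIntegrable 0 L) (hφ'.intervalIntegrable 0 L)
  have e2 := intervalIntegral.integral_add (μ := volume)
    ((h1.add h2).intervalIntegrable 0 L) (h3.intervalIntegrable 0 L)
  have e3 := intervalIntegral.integral_add (μ := volume)
    (h1.intervalIntegrable 0 L) (h2.intervalIntegrable 0 L)
  have e4 := intervalIntegral.integral_eq_sub_of_hasDerivAt (a := 0) (b := L)
    (fun x _ => hφ x) (hφ'.intervalIntegrable 0 L)
  simp only [intervalIntegral.integral_const_mul, Pi.add_apply] at e1 e2 e3 ⊢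
  rw [e1, e2, e3, e4]

/-- A fixed-time profile `f` of a solution of the linear KdV equation, together with its space
derivatives `f₁, f₂, f₃`, its time derivative `g`, and the space derivative `g₁` of `g`. -/
structure KdVProfile (L : ℝ) (f f₁ f₂ f₃ g g₁ : ℝ → ℝ) : Prop where
  hasDerivAt : ∀ x, HasDerivAt f (f₁ x) x
  hasDerivAt₁ : ∀ x, HasDerivAt f₁ (f₂ x) x
  hasDerivAt₂ : ∀ x, HasDerivAt f₂ (f₃ x) x
  hasDerivAt_time : ∀ x, HasDerivAt g (g₁ x) x
  continuous₃ : Continuous f₃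
  continuous_time : Continuous g₁
  equation : ∀ x ∈ Ioo 0 L, g x + f₁ x + f₃ x = 0
  left : f 0 = 0
  right : f L = 0
  right₁ : f₁ L = 0
  left_time : g 0 = 0
  right_time : g L = 0

namespace KdVProfile

variable {L : ℝ} {f f₁ f₂ f₃ g g₁ : ℝ → ℝ}

lemma continuous (h : KdVProfile L f f₁ f₂ f₃ g g₁) :
    Continuous f ∧ Continuous f₁ ∧ Continuous f₂ ∧ Continuous f₃ ∧ Continuous g ∧ Continuous g₁ :=
  ⟨continuous_iff_continuousAt.2 fun x => (h.hasDerivAt x).continuousAt,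
    continuous_iff_continuousAt.2 fun x => (h.hasDerivAt₁ x).continuousAt,
    continuous_iff_continuousAt.2 fun x => (h.hasDerivAt₂ x).continuousAt, h.continuous₃,
    continuous_iff_continuousAt.2 fun x => (h.hasDerivAt_time x).continuousAt, h.continuous_time⟩

/-- Weighted energy dissipation. -/
lemma energy_le (h : KdVProfile L f f₁ f₂ f₃ g g₁) (hL : 0 < L) :
    ∫ x in (0:ℝ)..L, x * (2 * f x * g x) ≤
      L * (∫ x in (0:ℝ)..L, x * f x ^ 2) - 2 * ∫ x in (0:ℝ)..L, f₁ x ^ 2 := by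
  obtain ⟨c, c1, c2, c3, cg, cg1⟩ := h.continuous
  have hφ : ∀ x, HasDerivAt (fun x => -2 * (x * (f x * f₂ x)) + 2 * (f x * f₁ x) + x * f₁ x ^ 2)
      (-2 * x * f x * f₃ x + 3 * f₁ x ^ 2) x := by
    intro x
    have := (((hasDerivAt_id' x).fun_mul ((h.hasDerivAt x).fun_mul (h.hasDerivAt₂ x))).const_mul
      (-2)).fun_add (((h.hasDerivAt x).fun_mul (h.hasDerivAt₁ x)).const_mul 2) |>.fun_add
      ((hasDerivAt_id' x).fun_mul ((h.hasDerivAt₁ x).fun_pow 2))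
    refine this.congr_deriv ?_
    push_cast
    ring
  have key := integral_le_combination_add_boundary hL.le (a := fun x => x * (2 * f x * g x))
    (p := fun x => x * f x ^ 2) (q := fun x => f₁ x ^ 2) (r := fun _ => 0)
    (by fun_prop) (by fun_prop) (by fun_prop) (by fun_prop) (by fun_prop) hφ L (-2) 0 ?_
  · simp only [h.left, h.right, h.right₁] at key
    linarith
  · intro x hx
    have hg : g x = -(f₁ x + f₃ x) := by linarith [h.equation x hx]
    have hxL : 0 ≤ (L - x) * x * f x ^ 2 :=
      mul_nonneg (mul_nonneg (by linarith [hx.2]) hx.1.le) (sq_nonneg _)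
    rw [hg]
    nlinarith [sq_nonneg (f₁ x + x * f x)]

/-- Poincaré inequality. -/
lemma integral_sq_le (h : KdVProfile L f f₁ f₂ f₃ g g₁) (hL : 0 < L) :
    ∫ x in (0:ℝ)..L, f x ^ 2 ≤ 4 * L ^ 2 * ∫ x in (0:ℝ)..L, f₁ x ^ 2 := by
  obtain ⟨c, c1, c2, c3, cg, cg1⟩ := h.continuous
  have hφ : ∀ x, HasDerivAt (fun x => 2 * (x * f x ^ 2))
      (2 * f x ^ 2 + 4 * x * f x * f₁ x) x := by
    intro x
    refine HasDerivAt.congr_deriv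
      (((hasDerivAt_id' x).fun_mul ((h.hasDerivAt x).fun_pow 2)).const_mul 2) ?_
    push_cast
    ring
  have key := integral_le_combination_add_boundary hL.le (a := fun x => f x ^ 2)
    (p := fun x => f₁ x ^ 2) (q := fun _ => 0) (r := fun _ => 0)
    (by fun_prop) (by fun_prop) (by fun_prop) (by fun_prop) (by fun_prop) hφ (4 * L ^ 2) 0 0 ?_
  · simp only [h.right] at key
    linarith
  · intro x hx
    have hxL : x ^ 2 * f₁ x ^ 2 ≤ L ^ 2 * f₁ x ^ 2 := by
      gcongr
      exacts [hx.1.le, hx.2.le]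
    nlinarith [sq_nonneg (f x + 2 * x * f₁ x)]

lemma integral_weighted_time_sq_le (h : KdVProfile L f f₁ f₂ f₃ g g₁) (hL : 0 < L) :
    ∫ x in (0:ℝ)..L, x * g x ^ 2 ≤ L * ∫ x in (0:ℝ)..L, g x ^ 2 := by
  obtain ⟨c, c1, c2, c3, cg, cg1⟩ := h.continuous
  rw [← intervalIntegral.integral_const_mul]
  refine intervalIntegral.integral_mono_on hL.le
    (Continuous.intervalIntegrable (by fun_prop) _ _)
    (Continuous.intervalIntegrable (by fun_prop) _ _) fun x hx => ?_
  exact mul_le_mul_of_nonneg_right hx.2 (sq_nonneg _)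

/-- Bound for the time derivative by neighbouring Sobolev norms. -/
lemma integral_time_sq_le (h : KdVProfile L f f₁ f₂ f₃ g g₁) (hL : 0 < L) {a : ℝ} (ha : 0 < a) :
    ∫ x in (0:ℝ)..L, g x ^ 2 ≤ (∫ x in (0:ℝ)..L, f₁ x ^ 2) + a * (∫ x in (0:ℝ)..L, g₁ x ^ 2) +
      a⁻¹ * ∫ x in (0:ℝ)..L, f₂ x ^ 2 := by
  obtain ⟨c, c1, c2, c3, cg, cg1⟩ := h.continuous
  have hφ : ∀ x, HasDerivAt (fun x => -2 * (g x * f₂ x))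
      (-2 * (g₁ x * f₂ x + g x * f₃ x)) x := fun x =>
    ((h.hasDerivAt_time x).mul (h.hasDerivAt₂ x)).const_mul (-2)
  have key := integral_le_combination_add_boundary hL.le (a := fun x => g x ^ 2)
    (p := fun x => f₁ x ^ 2) (q := fun x => g₁ x ^ 2) (r := fun x => f₂ x ^ 2)
    (by fun_prop) (by fun_prop) (by fun_prop) (by fun_prop) (by fun_prop) hφ 1 a a⁻¹ ?_
  · simp only [h.left_time, h.right_time] at key
    linarith
  · intro x hx
    have hf : f₃ x = -(g x + f₁ x) := by linarith [h.equation x hx]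
    have hy : 0 ≤ a * (g₁ x - a⁻¹ * f₂ x) ^ 2 := by positivity
    have hy' : a * (g₁ x - a⁻¹ * f₂ x) ^ 2 =
        a * g₁ x ^ 2 - 2 * g₁ x * f₂ x + a⁻¹ * f₂ x ^ 2 := by field_simp; ring
    rw [hf]
    nlinarith [sq_nonneg (g x + f₁ x)]

/-- Bound for the second derivative up to a boundary term at the left end point. -/
lemma integral_second_sq_le (h : KdVProfile L f f₁ f₂ f₃ g g₁) (hL : 0 < L) {b : ℝ}
    (hb : 0 < b) :
    ∫ x in (0:ℝ)..L, f₂ x ^ 2 ≤ (1 + b⁻¹) * (∫ x in (0:ℝ)..L, f₁ x ^ 2) +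
      b * (∫ x in (0:ℝ)..L, g x ^ 2) - f₁ 0 * f₂ 0 := by
  obtain ⟨c, c1, c2, c3, cg, cg1⟩ := h.continuous
  have hφ : ∀ x, HasDerivAt (fun x => f₁ x * f₂ x) (f₂ x * f₂ x + f₁ x * f₃ x) x := fun x =>
    (h.hasDerivAt₁ x).mul (h.hasDerivAt₂ x)
  have key := integral_le_combination_add_boundary hL.le (a := fun x => f₂ x ^ 2)
    (p := fun x => f₁ x ^ 2) (q := fun x => g x ^ 2) (r := fun _ => 0)
    (by fun_prop) (by fun_prop) (by fun_prop) (by fun_prop) (by fun_prop) hφ (1 + b⁻¹) b 0 ?_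
  · simp only [h.right₁] at key
    linarith
  · intro x hx
    have hf : f₃ x = -(g x + f₁ x) := by linarith [h.equation x hx]
    have hy : 0 ≤ b * (g x - b⁻¹ * f₁ x) ^ 2 := by positivity
    have hy' : b * (g x - b⁻¹ * f₁ x) ^ 2 =
        b * g x ^ 2 - 2 * g x * f₁ x + b⁻¹ * f₁ x ^ 2 := by field_simp; ring
    have hb' : 0 ≤ b * g x ^ 2 + b⁻¹ * f₁ x ^ 2 := by positivity
    rw [hf]
    nlinarith

lemma trace_first_sq_le (h : KdVProfile L f f₁ f₂ f₃ g g₁) (hL : 0 < L) {b : ℝ} (hb : 0 < b) :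
    f₁ 0 ^ 2 ≤ b * (∫ x in (0:ℝ)..L, f₂ x ^ 2) + b⁻¹ * ∫ x in (0:ℝ)..L, f₁ x ^ 2 := by
  obtain ⟨c, c1, c2, c3, cg, cg1⟩ := h.continuous
  have hφ : ∀ x, HasDerivAt (fun x => f₁ x * f₁ x) (f₂ x * f₁ x + f₁ x * f₂ x) x := fun x =>
    (h.hasDerivAt₁ x).mul (h.hasDerivAt₁ x)
  have key := integral_le_combination_add_boundary hL.le (a := fun _ => 0)
    (p := fun x => f₂ x ^ 2) (q := fun x => f₁ x ^ 2) (r := fun _ => 0)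
    (by fun_prop) (by fun_prop) (by fun_prop) (by fun_prop) (by fun_prop) hφ b b⁻¹ 0 ?_
  · simp only [h.right₁, intervalIntegral.integral_zero] at key
    linarith
  · intro x _
    have hy : 0 ≤ b * (f₂ x + b⁻¹ * f₁ x) ^ 2 := by positivity
    have hy' : b * (f₂ x + b⁻¹ * f₁ x) ^ 2 =
        b * f₂ x ^ 2 + 2 * f₂ x * f₁ x + b⁻¹ * f₁ x ^ 2 := by field_simp; ring
    nlinarith

lemma trace_second_sq_le (h : KdVProfile L f f₁ f₂ f₃ g g₁) (hL : 0 < L) {d : ℝ} (hd : 0 < d) :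
    f₂ 0 ^ 2 ≤ (L⁻¹ + d) * (∫ x in (0:ℝ)..L, f₂ x ^ 2) +
      2 * d⁻¹ * ((∫ x in (0:ℝ)..L, g x ^ 2) + ∫ x in (0:ℝ)..L, f₁ x ^ 2) := by
  obtain ⟨c, c1, c2, c3, cg, cg1⟩ := h.continuous
  have hφ : ∀ x, HasDerivAt (fun x => (L - x) * f₂ x ^ 2)
      (-f₂ x ^ 2 + 2 * (L - x) * f₂ x * f₃ x) x := by
    intro x
    refine HasDerivAt.congr_deriv
      (((hasDerivAt_id' x).const_sub L).fun_mul ((h.hasDerivAt₂ x).fun_pow 2)) ?_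
    push_cast
    ring
  have key := integral_le_combination_add_boundary hL.le (a := fun _ => 0)
    (p := fun x => f₂ x ^ 2) (q := fun x => g x ^ 2) (r := fun x => f₁ x ^ 2)
    (by fun_prop) (by fun_prop) (by fun_prop) (by fun_prop) (by fun_prop) hφ
    (1 + L * d) (L * (2 * d⁻¹)) (L * (2 * d⁻¹)) ?_
  · simp only [intervalIntegral.integral_zero] at key
    have := mul_inv_cancel₀ hL.ne'
    refine le_of_mul_le_mul_left ?_ hL
    rw [mul_add, ← mul_assoc L (L⁻¹ + d), mul_add, this]
    linarith
  · intro x hx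
    have hf : f₃ x ^ 2 ≤ 2 * (g x ^ 2 + f₁ x ^ 2) := by
      have : f₃ x = -(g x + f₁ x) := by linarith [h.equation x hx]
      rw [this]
      nlinarith [sq_nonneg (g x - f₁ x)]
    have hy : 0 ≤ d * (f₂ x + d⁻¹ * f₃ x) ^ 2 := by positivity
    have hy' : d * (f₂ x + d⁻¹ * f₃ x) ^ 2 =
        d * f₂ x ^ 2 + 2 * f₂ x * f₃ x + d⁻¹ * f₃ x ^ 2 := by field_simp; ring
    have h1 := mul_nonneg (sub_nonneg.2 hx.2.le) hy
    have h2 : 0 ≤ x * (d * f₂ x ^ 2 + d⁻¹ * f₃ x ^ 2) := mul_nonneg hx.1.le (by positivity)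
    have h3 := mul_le_mul_of_nonneg_left hf (by positivity : 0 ≤ L * d⁻¹)
    rw [hy'] at h1
    nlinarith

/-- Interpolation of the second derivative between the first derivative and the time derivative. -/
lemma integral_second_sq_interpolation (h : KdVProfile L f f₁ f₂ f₃ g g₁) (hL : 0 < L) {r : ℝ}
    (hr : 0 < r) (hrL : 16 * r ≤ L ^ 2) :
    3 * (∫ x in (0:ℝ)..L, f₂ x ^ 2) ≤ 24 * r * (∫ x in (0:ℝ)..L, g x ^ 2) +
      (16 * r⁻¹ + 8 + 16 * r) * ∫ x in (0:ℝ)..L, f₁ x ^ 2 := by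
  have hP : 0 ≤ ∫ x in (0:ℝ)..L, g x ^ 2 :=
    intervalIntegral.integral_nonneg hL.le fun _ _ => sq_nonneg _
  have hS : 0 ≤ ∫ x in (0:ℝ)..L, f₂ x ^ 2 :=
    intervalIntegral.integral_nonneg hL.le fun _ _ => sq_nonneg _
  obtain ⟨e, he, rfl⟩ : ∃ e : ℝ, 0 < e ∧ r = e ^ 2 :=
    ⟨√r, Real.sqrt_pos.2 hr, (Real.sq_sqrt hr.le).symm⟩
  have heL : 4 * e ≤ L := by nlinarith
  have h1 := h.integral_second_sq_le hL hr
  have h2 := h.trace_first_sq_le hL (half_pos he)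
  have h3 := h.trace_second_sq_le hL (d := (2 * e)⁻¹) (by positivity)
  have h4 : -(f₁ 0 * f₂ 0) ≤ (2 * e)⁻¹ * f₁ 0 ^ 2 + e / 2 * f₂ 0 ^ 2 := by
    have : (2 * e)⁻¹ * f₁ 0 ^ 2 + e / 2 * f₂ 0 ^ 2 + f₁ 0 * f₂ 0 =
        (2 * e)⁻¹ * (f₁ 0 + e * f₂ 0) ^ 2 := by field_simp; ring
    have : 0 ≤ (2 * e)⁻¹ * (f₁ 0 + e * f₂ 0) ^ 2 := by positivity
    linarith
  have hLe : e * L⁻¹ ≤ 1 / 4 := by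
    rw [← div_eq_mul_inv, div_le_iff₀ hL]; linarith
  generalize (∫ x in (0:ℝ)..L, g x ^ 2) = P at *
  generalize (∫ x in (0:ℝ)..L, f₂ x ^ 2) = S at *
  generalize (∫ x in (0:ℝ)..L, f₁ x ^ 2) = H at *
  have h5 := mul_le_mul_of_nonneg_left h2 (by positivity : 0 ≤ (2 * e)⁻¹)
  have h6 := mul_le_mul_of_nonneg_left h3 (by positivity : 0 ≤ e / 2)
  have h7 : (2 * e)⁻¹ * (e / 2 * S + (e / 2)⁻¹ * H) = S / 4 + (e ^ 2)⁻¹ * H := by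
    field_simp; ring
  have h8 : e / 2 * ((L⁻¹ + (2 * e)⁻¹) * S + 2 * (2 * e)⁻¹⁻¹ * (P + H)) =
      e * L⁻¹ * S / 2 + S / 4 + 2 * e ^ 2 * (P + H) := by
    field_simp; ring
  have h9 := mul_le_mul_of_nonneg_right hLe hS
  nlinarith

end KdVProfile

section PartialDerivatives

variable {w : ℝ → ℝ → ℝ}

lemma hasDerivAt_space_fderiv (hw : ContDiff ℝ (⊤ : ℕ∞) (uncurry w)) (t x : ℝ) :
    HasDerivAt (w t) (fderiv ℝ (uncurry w) (t, x) (0, 1)) x :=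
  ((hw.differentiable (by simp)) (t, x)).hasFDerivAt.comp_hasDerivAt x
    ((hasDerivAt_const x t).prodMk (hasDerivAt_id' x))

lemma hasDerivAt_time_fderiv (hw : ContDiff ℝ (⊤ : ℕ∞) (uncurry w)) (t x : ℝ) :
    HasDerivAt (fun s => w s x) (fderiv ℝ (uncurry w) (t, x) (1, 0)) t :=
  ((hw.differentiable (by simp)) (t, x)).hasFDerivAt.comp_hasDerivAt t
    (f := fun s => (s, x)) ((hasDerivAt_id' t).prodMk (hasDerivAt_const t x))

lemma pdx_eq_fderiv (hw : ContDiff ℝ (⊤ : ℕ∞) (uncurry w)) (t x : ℝ) :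
    pdx w t x = fderiv ℝ (uncurry w) (t, x) (0, 1) :=
  (hasDerivAt_space_fderiv hw t x).deriv

lemma pdt_eq_fderiv (hw : ContDiff ℝ (⊤ : ℕ∞) (uncurry w)) (t x : ℝ) :
    pdt w t x = fderiv ℝ (uncurry w) (t, x) (1, 0) :=
  (hasDerivAt_time_fderiv hw t x).deriv

lemma hasDerivAt_pdx (hw : ContDiff ℝ (⊤ : ℕ∞) (uncurry w)) (t x : ℝ) :
    HasDerivAt (w t) (pdx w t x) x :=
  (hasDerivAt_space_fderiv hw t x).differentiableAt.hasDerivAt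

lemma hasDerivAt_pdt (hw : ContDiff ℝ (⊤ : ℕ∞) (uncurry w)) (t x : ℝ) :
    HasDerivAt (fun s => w s x) (pdt w t x) t :=
  (hasDerivAt_time_fderiv hw t x).differentiableAt.hasDerivAt

lemma uncurry_pdx (hw : ContDiff ℝ (⊤ : ℕ∞) (uncurry w)) :
    uncurry (pdx w) = fun z => fderiv ℝ (uncurry w) z (0, 1) :=
  funext fun z => pdx_eq_fderiv hw z.1 z.2

lemma uncurry_pdt (hw : ContDiff ℝ (⊤ : ℕ∞) (uncurry w)) :
    uncurry (pdt w) = fun z => fderiv ℝ (uncurry w) z (1, 0) :=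
  funext fun z => pdt_eq_fderiv hw z.1 z.2

lemma contDiff_pdx (hw : ContDiff ℝ (⊤ : ℕ∞) (uncurry w)) :
    ContDiff ℝ (⊤ : ℕ∞) (uncurry (pdx w)) := by
  rw [uncurry_pdx hw]
  exact (hw.fderiv_right (by simp)).clm_apply contDiff_const

lemma contDiff_pdt (hw : ContDiff ℝ (⊤ : ℕ∞) (uncurry w)) :
    ContDiff ℝ (⊤ : ℕ∞) (uncurry (pdt w)) := by
  rw [uncurry_pdt hw]
  exact (hw.fderiv_right (by simp)).clm_apply contDiff_const

lemma pdt_pdx_comm (hw : ContDiff ℝ (⊤ : ℕ∞) (uncurry w)) : pdt (pdx w) = pdx (pdt w) := by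
  funext t x
  have hd : DifferentiableAt ℝ (fderiv ℝ (uncurry w)) (t, x) :=
    ((hw.fderiv_right (m := 1) (by
      simp only [one_add_one_eq_two]
      exact WithTop.coe_le_coe.2 le_top)).differentiable one_ne_zero) _
  have hs : IsSymmSndFDerivAt ℝ (uncurry w) (t, x) :=
    hw.contDiffAt.isSymmSndFDerivAt (by
      simp only [minSmoothness_of_isRCLikeNormedField]
      exact WithTop.coe_le_coe.2 le_top)
  rw [pdt_eq_fderiv (contDiff_pdx hw), pdx_eq_fderiv (contDiff_pdt hw), uncurry_pdx hw,
    uncurry_pdt hw, fderiv_clm_apply hd (differentiableAt_const _),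
    fderiv_clm_apply hd (differentiableAt_const _)]
  simpa using hs.eq (1, 0) (0, 1)

/-- Differentiation of an integral over an interval with respect to a parameter. -/
lemma hasDerivAt_integral_of_continuous {F F' : ℝ → ℝ → ℝ} (hF : Continuous (uncurry F))
    (hF' : Continuous (uncurry F')) (h : ∀ t x, HasDerivAt (fun s => F s x) (F' t x) t)
    (a b t : ℝ) :
    HasDerivAt (fun s => ∫ x in a..b, F s x) (∫ x in a..b, F' t x) t := by
  obtain ⟨M, hM⟩ := ((isCompact_closedBall t 1).prod
    (isCompact_uIcc (a := a) (b := b))).exists_bound_of_continuousOn hF'.continuousOn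
  refine (intervalIntegral.hasDerivAt_integral_of_dominated_loc_of_deriv_le
    (bound := fun _ => M) (Metric.closedBall_mem_nhds t one_pos)
    (.of_forall fun s => (hF.uncurry_left s).aestronglyMeasurable)
    ((hF.uncurry_left t).intervalIntegrable _ _) (hF'.uncurry_left t).aestronglyMeasurable
    (.of_forall fun x hx s hs => hM (s, x) ⟨hs, uIoc_subset_uIcc hx⟩)
    intervalIntegrable_const (.of_forall fun x _ s _ => h s x)).2

lemma hasDerivAt_weighted_energy (hw : ContDiff ℝ (⊤ : ℕ∞) (uncurry w)) (L t : ℝ) :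
    HasDerivAt (fun s => ∫ x in (0:ℝ)..L, x * w s x ^ 2)
      (∫ x in (0:ℝ)..L, x * (2 * w t x * pdt w t x)) t := by
  have h0 : Continuous fun z : ℝ × ℝ => w z.1 z.2 := hw.continuous
  have h1 : Continuous fun z : ℝ × ℝ => pdt w z.1 z.2 := (contDiff_pdt hw).continuous
  refine hasDerivAt_integral_of_continuous (F := fun s x => x * w s x ^ 2)
    (F' := fun s x => x * (2 * w s x * pdt w s x)) ?_ ?_ (fun s x => ?_) 0 L t
  · simp only [uncurry_def]; fun_prop
  · simp only [uncurry_def]; fun_prop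
  · refine HasDerivAt.congr_deriv (((hasDerivAt_pdt hw s x).fun_pow 2).const_mul x) ?_
    push_cast
    ring

lemma continuous_integral_sq {v : ℝ → ℝ → ℝ} (hv : ContDiff ℝ (⊤ : ℕ∞) (uncurry v)) (L : ℝ) :
    Continuous fun t => ∫ x in (0:ℝ)..L, v t x ^ 2 := by
  have h0 : Continuous fun z : ℝ × ℝ => v z.1 z.2 := hv.continuous
  exact intervalIntegral.continuous_parametric_intervalIntegral_of_continuous'
    (f := fun t x => v t x ^ 2) (by simp only [uncurry_def]; fun_prop) 0 L

lemma continuous_weighted_energy_deriv (hw : ContDiff ℝ (⊤ : ℕ∞) (uncurry w)) (L : ℝ) :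
    Continuous fun t => ∫ x in (0:ℝ)..L, x * (2 * w t x * pdt w t x) := by
  have h0 : Continuous fun z : ℝ × ℝ => w z.1 z.2 := hw.continuous
  have h1 : Continuous fun z : ℝ × ℝ => pdt w z.1 z.2 := (contDiff_pdt hw).continuous
  exact intervalIntegral.continuous_parametric_intervalIntegral_of_continuous'
    (f := fun t x => x * (2 * w t x * pdt w t x)) (by simp only [uncurry_def]; fun_prop) 0 L

lemma pdt_eq_zero {T t x : ℝ} (ht : t ∈ Ioo 0 T) (h : ∀ s ∈ Ioo 0 T, w s x = 0) :
    pdt w t x = 0 := by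
  have : (fun s => w s x) =ᶠ[𝓝 t] fun _ => 0 :=
    eventually_of_mem (isOpen_Ioo.mem_nhds ht) h
  simp only [pdt, this.deriv_eq, deriv_const]

end PartialDerivatives

/-- A smooth function solving the linear KdV equation on the rectangle `(0, T) × (0, L)` with
homogeneous boundary conditions at positive times. -/
structure IsLinearKdVSolution (L T : ℝ) (w : ℝ → ℝ → ℝ) : Prop where
  contDiff : ContDiff ℝ (⊤ : ℕ∞) (uncurry w)
  equation : ∀ t ∈ Ioo 0 T, ∀ x ∈ Ioo 0 L, pdt w t x + pdx w t x + pdx (pdx (pdx w)) t x = 0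
  left : ∀ t ∈ Ioo 0 T, w t 0 = 0
  right : ∀ t ∈ Ioo 0 T, w t L = 0
  right_pdx : ∀ t ∈ Ioo 0 T, pdx w t L = 0

namespace IsLinearKdVSolution

variable {L T : ℝ} {w : ℝ → ℝ → ℝ}

lemma timeDeriv (h : IsLinearKdVSolution L T w) : IsLinearKdVSolution L T (pdt w) where
  contDiff := contDiff_pdt h.contDiff
  left t ht := pdt_eq_zero ht h.left
  right t ht := pdt_eq_zero ht h.right
  right_pdx t ht := by
    rw [← pdt_pdx_comm h.contDiff]
    exact pdt_eq_zero ht h.right_pdx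
  equation t ht x hx := by
    have h1 := contDiff_pdx h.contDiff
    have h2 := contDiff_pdx h1
    have key := ((hasDerivAt_pdt (contDiff_pdt h.contDiff) t x).add (hasDerivAt_pdt h1 t x)).add
      (hasDerivAt_pdt (contDiff_pdx h2) t x)
    rw [← pdt_pdx_comm h.contDiff, ← pdt_pdx_comm h1, ← pdt_pdx_comm h2]
    refine key.unique ((hasDerivAt_const t (0 : ℝ)).congr_of_eventuallyEq ?_)
    exact eventually_of_mem (isOpen_Ioo.mem_nhds ht) fun s hs => h.equation s hs x hx

lemma profile (h : IsLinearKdVSolution L T w) {t : ℝ} (ht : t ∈ Ioo 0 T) :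
    KdVProfile L (w t) (pdx w t) (pdx (pdx w) t) (pdx (pdx (pdx w)) t) (pdt w t)
      (pdx (pdt w) t) where
  hasDerivAt := hasDerivAt_pdx h.contDiff t
  hasDerivAt₁ := hasDerivAt_pdx (contDiff_pdx h.contDiff) t
  hasDerivAt₂ := hasDerivAt_pdx (contDiff_pdx (contDiff_pdx h.contDiff)) t
  hasDerivAt_time := hasDerivAt_pdx h.timeDeriv.contDiff t
  continuous₃ := (contDiff_pdx (contDiff_pdx (contDiff_pdx h.contDiff))).continuous.uncurry_left t
  continuous_time := (contDiff_pdx h.timeDeriv.contDiff).continuous.uncurry_left t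
  equation := h.equation t ht
  left := h.left t ht
  right := h.right t ht
  right₁ := h.right_pdx t ht
  left_time := h.timeDeriv.left t ht
  right_time := h.timeDeriv.right t ht

/-- Kato smoothing: weighted `L²` data control the solution in `L²(0, T; H¹)`. -/
lemma integral_integral_pdx_sq_le (h : IsLinearKdVSolution L T w) (hL : 0 < L) (hT : 0 < T) :
    ∫ t in (0:ℝ)..T, ∫ x in (0:ℝ)..L, pdx w t x ^ 2 ≤
      Real.exp (L * T) * ∫ x in (0:ℝ)..L, x * w 0 x ^ 2 := by
  have hE := hasDerivAt_weighted_energy h.contDiff L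
  have hφ : ∀ t, HasDerivAt (fun s => Real.exp (L * T) *
      (Real.exp (-L * s) * ∫ x in (0:ℝ)..L, x * w s x ^ 2))
      (Real.exp (L * T) * (Real.exp (-L * t) *
        ((∫ x in (0:ℝ)..L, x * (2 * w t x * pdt w t x)) -
          L * ∫ x in (0:ℝ)..L, x * w t x ^ 2))) t := by
    intro t
    refine HasDerivAt.congr_deriv
      (((((hasDerivAt_id' t).const_mul (-L)).exp).fun_mul (hE t)).const_mul
      (Real.exp (L * T))) ?_
    ring
  have cE : Continuous fun t => ∫ x in (0:ℝ)..L, x * w t x ^ 2 :=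
    continuous_iff_continuousAt.2 fun t => (hE t).continuousAt
  have cE' := continuous_weighted_energy_deriv h.contDiff L
  have cH := continuous_integral_sq (contDiff_pdx h.contDiff) L
  have key := integral_le_combination_add_boundary hT.le
    (a := fun t => 2 * ∫ x in (0:ℝ)..L, pdx w t x ^ 2) (p := fun _ => 0) (q := fun _ => 0)
    (r := fun _ => 0) (φ := fun s => -(Real.exp (L * T) *
      (Real.exp (-L * s) * ∫ x in (0:ℝ)..L, x * w s x ^ 2)))
    (by fun_prop) (by fun_prop) (by fun_prop) (by fun_prop)
    (by fun_prop) (fun t => (hφ t).neg) 0 0 0 ?_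
  · have hET : 0 ≤ ∫ x in (0:ℝ)..L, x * w T x ^ 2 :=
      intervalIntegral.integral_nonneg hL.le fun x hx => mul_nonneg hx.1 (sq_nonneg _)
    have hE0 : 0 ≤ ∫ x in (0:ℝ)..L, x * w 0 x ^ 2 :=
      intervalIntegral.integral_nonneg hL.le fun x hx => mul_nonneg hx.1 (sq_nonneg _)
    have h1 : 0 ≤ Real.exp (L * T) * (Real.exp (-L * T) * ∫ x in (0:ℝ)..L, x * w T x ^ 2) := by
      positivity
    have h2 : 0 ≤ Real.exp (L * T) * ∫ x in (0:ℝ)..L, x * w 0 x ^ 2 := by positivity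
    simp only [intervalIntegral.integral_const_mul, mul_zero, Real.exp_zero, one_mul] at key
    linarith
  · intro t ht
    have hd := (h.profile ht).energy_le hL
    have hH : 0 ≤ ∫ x in (0:ℝ)..L, pdx w t x ^ 2 :=
      intervalIntegral.integral_nonneg hL.le fun _ _ => sq_nonneg _
    have hexp : 1 ≤ Real.exp (L * T) * Real.exp (-L * t) := by
      rw [← Real.exp_add]
      refine Real.one_le_exp ?_
      nlinarith [mul_pos hL (sub_pos.2 ht.2)]
    nlinarith [mul_le_mul_of_nonneg_left hexp hH, mul_le_mul_of_nonneg_left hd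
      (zero_le_one.trans hexp)]

end IsLinearKdVSolution

/-- Pointwise-in-time interpolation: the time-weighted norms of the second space derivative and of
the time derivative are controlled by the `H¹` norm, up to a small multiple of the
highest-order dissipation. -/
lemma KdVProfile.interpolation (L T η : ℝ) (hL : 0 < L) (hT : 0 < T) (hη : 0 < η) :
    ∃ C : ℝ, 0 < C ∧ ∀ t ∈ Ioo 0 T, ∀ f f₁ f₂ f₃ g g₁ : ℝ → ℝ,
      KdVProfile L f f₁ f₂ f₃ g g₁ →
        t ^ 2 * (∫ x in (0:ℝ)..L, g x ^ 2) ≤ C * (∫ x in (0:ℝ)..L, f₁ x ^ 2) +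
          2 * η * (t ^ 3 * ∫ x in (0:ℝ)..L, g₁ x ^ 2) ∧
        t * (∫ x in (0:ℝ)..L, f₂ x ^ 2) ≤ C * (∫ x in (0:ℝ)..L, f₁ x ^ 2) +
          2 * η ^ 2 * (t ^ 3 * ∫ x in (0:ℝ)..L, g₁ x ^ 2) := by
  obtain ⟨k, hk, hkL, hkη⟩ : ∃ k : ℝ, 0 < k ∧ 16 * (k * T) ≤ L ^ 2 ∧ 16 * k ≤ η := by
    refine ⟨min (L ^ 2 / (16 * T)) (η / 16), by positivity, ?_, ?_⟩
    · have := min_le_left (L ^ 2 / (16 * T)) (η / 16)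
      rw [le_div_iff₀ (by positivity)] at this
      linarith
    · have := min_le_right (L ^ 2 / (16 * T)) (η / 16)
      linarith
  set A : ℝ := 16 * k⁻¹ + 8 * T + 16 * (k * T ^ 2) with hA
  have hA0 : 0 < A := by positivity
  set B : ℝ := 2 * (T ^ 2 + η⁻¹ * A) with hB
  have hB0 : 0 < B := by positivity
  refine ⟨B + η * B + A, by positivity, fun t ht f f₁ f₂ f₃ g g₁ h => ?_⟩
  have ht0 := ht.1
  have hkt : k * t ≤ k * T := by gcongr; exact ht.2.le
  have h1 := h.integral_second_sq_interpolation hL (mul_pos hk ht0) (by linarith)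
  have h2 := h.integral_time_sq_le hL (mul_pos hη ht0)
  have hP : 0 ≤ ∫ x in (0:ℝ)..L, g x ^ 2 :=
    intervalIntegral.integral_nonneg hL.le fun _ _ => sq_nonneg _
  have hS : 0 ≤ ∫ x in (0:ℝ)..L, f₂ x ^ 2 :=
    intervalIntegral.integral_nonneg hL.le fun _ _ => sq_nonneg _
  have hH : 0 ≤ ∫ x in (0:ℝ)..L, f₁ x ^ 2 :=
    intervalIntegral.integral_nonneg hL.le fun _ _ => sq_nonneg _
  have hG : 0 ≤ ∫ x in (0:ℝ)..L, g₁ x ^ 2 :=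
    intervalIntegral.integral_nonneg hL.le fun _ _ => sq_nonneg _
  generalize (∫ x in (0:ℝ)..L, g x ^ 2) = P at *
  generalize (∫ x in (0:ℝ)..L, f₂ x ^ 2) = S at *
  generalize (∫ x in (0:ℝ)..L, f₁ x ^ 2) = H at *
  generalize (∫ x in (0:ℝ)..L, g₁ x ^ 2) = G at *
  have hS' : t * S ≤ η / 2 * (t ^ 2 * P) + A * H := by
    have e1 : t * (24 * (k * t) * P + (16 * (k * t)⁻¹ + 8 + 16 * (k * t)) * H) =
        24 * k * (t ^ 2 * P) + (16 * k⁻¹ + 8 * t + 16 * (k * t ^ 2)) * H := by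
      field_simp
    have e2 : 16 * k⁻¹ + 8 * t + 16 * (k * t ^ 2) ≤ A := by
      rw [hA]; gcongr <;> exact ht.2.le
    have e3 := mul_le_mul_of_nonneg_right e2 hH
    have e4 : 24 * k * (t ^ 2 * P) ≤ 3 * (η / 2) * (t ^ 2 * P) :=
      mul_le_mul_of_nonneg_right (by linarith) (by positivity)
    have e5 := mul_le_mul_of_nonneg_left h1 ht0.le
    have e6 : 0 ≤ A * H := by positivity
    linarith
  have hP' : t ^ 2 * P ≤ B * H + 2 * η * (t ^ 3 * G) := by
    have e1 : t ^ 2 * (H + η * t * G + (η * t)⁻¹ * S) =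
        t ^ 2 * H + η * (t ^ 3 * G) + η⁻¹ * (t * S) := by
      field_simp
    have e2 := mul_le_mul_of_nonneg_left h2 (sq_nonneg t)
    have e3 : t ^ 2 * H ≤ T ^ 2 * H := by gcongr; exact ht.2.le
    have e4 := mul_le_mul_of_nonneg_left hS' (inv_nonneg.2 hη.le)
    have e5 : η⁻¹ * (η / 2 * (t ^ 2 * P) + A * H) = t ^ 2 * P / 2 + η⁻¹ * A * H := by
      field_simp
    rw [hB]
    linarith
  have hBH : 0 ≤ B * H := by positivity
  have hAH : 0 ≤ A * H := by positivity
  have hηBH : 0 ≤ η * (B * H) := by positivity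
  have hGG : 0 ≤ η ^ 2 * (t ^ 3 * G) := by positivity
  refine ⟨by linarith, ?_⟩
  have := mul_le_mul_of_nonneg_left hP' (half_pos hη).le
  linarith

/-- Time-weighted dissipation of the weighted energy of the time derivative. -/
lemma IsLinearKdVSolution.integral_higher_dissipation_le {L T C : ℝ} {w : ℝ → ℝ → ℝ}
    (h : IsLinearKdVSolution L T w) (hL : 0 < L) (hT : 0 < T)
    (hC : ∀ t ∈ Ioo 0 T, (L * T + 3) * L * (t ^ 2 * ∫ x in (0:ℝ)..L, pdt w t x ^ 2) ≤
      C * (∫ x in (0:ℝ)..L, pdx w t x ^ 2) +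
        t ^ 3 * ∫ x in (0:ℝ)..L, pdx (pdt w) t x ^ 2) :
    ∫ t in (0:ℝ)..T, t ^ 3 * (∫ x in (0:ℝ)..L, pdx (pdt w) t x ^ 2) ≤
      C * ∫ t in (0:ℝ)..T, ∫ x in (0:ℝ)..L, pdx w t x ^ 2 := by
  have hu := h.timeDeriv.contDiff
  have hF := hasDerivAt_weighted_energy hu L
  have hφ : ∀ t, HasDerivAt (fun s => -(s ^ 3 * ∫ x in (0:ℝ)..L, x * pdt w s x ^ 2))
      (-(3 * t ^ 2 * (∫ x in (0:ℝ)..L, x * pdt w t x ^ 2) + t ^ 3 *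
        ∫ x in (0:ℝ)..L, x * (2 * pdt w t x * pdt (pdt w) t x))) t := by
    intro t
    refine HasDerivAt.congr_deriv ((((hasDerivAt_id' t).fun_pow 3).fun_mul (hF t)).fun_neg) ?_
    push_cast
    ring
  have cF : Continuous fun t => ∫ x in (0:ℝ)..L, x * pdt w t x ^ 2 :=
    continuous_iff_continuousAt.2 fun t => (hF t).continuousAt
  have cF' := continuous_weighted_energy_deriv hu L
  have cH := continuous_integral_sq (contDiff_pdx h.contDiff) L
  have cG := continuous_integral_sq (contDiff_pdx hu) L
  have key := integral_le_combination_add_boundary hT.le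
    (a := fun t => t ^ 3 * ∫ x in (0:ℝ)..L, pdx (pdt w) t x ^ 2)
    (p := fun t => ∫ x in (0:ℝ)..L, pdx w t x ^ 2) (q := fun _ => 0) (r := fun _ => 0)
    (by fun_prop) (by fun_prop) (by fun_prop) (by fun_prop) (by fun_prop) hφ C 0 0 ?_
  · have hFT : 0 ≤ ∫ x in (0:ℝ)..L, x * pdt w T x ^ 2 :=
      intervalIntegral.integral_nonneg hL.le fun x hx => mul_nonneg hx.1 (sq_nonneg _)
    have : 0 ≤ T ^ 3 * ∫ x in (0:ℝ)..L, x * pdt w T x ^ 2 := by positivity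
    linarith
  · intro t ht
    have hd := mul_le_mul_of_nonneg_left ((h.timeDeriv.profile ht).energy_le hL) (pow_pos ht.1 3).le
    have hF0 : 0 ≤ ∫ x in (0:ℝ)..L, x * pdt w t x ^ 2 :=
      intervalIntegral.integral_nonneg hL.le fun x hx => mul_nonneg hx.1 (sq_nonneg _)
    have hFP := mul_le_mul_of_nonneg_left ((h.profile ht).integral_weighted_time_sq_le hL)
      (mul_nonneg (by positivity : 0 ≤ L * T + 3) (sq_nonneg t))
    have ht3 : L * (t ^ 2 * t * ∫ x in (0:ℝ)..L, x * pdt w t x ^ 2) ≤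
        L * (t ^ 2 * T * ∫ x in (0:ℝ)..L, x * pdt w t x ^ 2) := by
      gcongr
      exact ht.2.le
    have := hC t ht
    linarith

/-- time-weighted `H²` smoothing for the linear KdV equation:
`∫₀^T t ‖w(t,·)‖²_{H²(0,L)} dt ≤ C ∫₀^L x w(0,x)² dx`. -/
theorem stmt_19 (L T : ℝ) (hL : 0 < L) (hT : 0 < T) :
    ∃ C : ℝ, 0 < C ∧
      ∀ w : ℝ → ℝ → ℝ, ContDiff ℝ (⊤ : ℕ∞) (Function.uncurry w) →
        (∀ t ∈ Set.Ioo (0:ℝ) T, ∀ x ∈ Set.Ioo (0:ℝ) L,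
          pdt w t x + pdx w t x + pdx (pdx (pdx w)) t x = 0) →
        (∀ t ∈ Set.Icc (0:ℝ) T, w t 0 = 0 ∧ w t L = 0 ∧ pdx w t L = 0) →
        (∫ t in (0:ℝ)..T, t * ∫ x in (0:ℝ)..L,
            ((w t x) ^ 2 + (pdx w t x) ^ 2 + (pdx (pdx w) t x) ^ 2)) ≤
          C * ∫ x in (0:ℝ)..L, x * (w 0 x) ^ 2 := by
  set M : ℝ := (L * T + 3) * L with hM
  have hM0 : 0 < M := by positivity
  obtain ⟨C, hC, hint⟩ := KdVProfile.interpolation L T (2 * M)⁻¹ hL hT (by positivity)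
  set D : ℝ := T * (4 * L ^ 2 + 1) + C with hD
  have hD0 : 0 < D := by positivity
  refine ⟨(D + 2 * (2 * M)⁻¹ ^ 2 * (M * C)) * Real.exp (L * T), by positivity,
    fun w hw heq hbc => ?_⟩
  have h : IsLinearKdVSolution L T w :=
    ⟨hw, heq, fun t ht => (hbc t (Ioo_subset_Icc_self ht)).1,
      fun t ht => (hbc t (Ioo_subset_Icc_self ht)).2.1,
      fun t ht => (hbc t (Ioo_subset_Icc_self ht)).2.2⟩
  have hw1 := contDiff_pdx hw
  have hw2 := contDiff_pdx hw1
  have cW := continuous_integral_sq hw L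
  have cH := continuous_integral_sq hw1 L
  have cS := continuous_integral_sq hw2 L
  have cG := continuous_integral_sq (contDiff_pdx h.timeDeriv.contDiff) L
  have hsum : ∀ t, ∫ x in (0:ℝ)..L, ((w t x) ^ 2 + (pdx w t x) ^ 2 + (pdx (pdx w) t x) ^ 2) =
      (∫ x in (0:ℝ)..L, w t x ^ 2) + (∫ x in (0:ℝ)..L, pdx w t x ^ 2) +
        ∫ x in (0:ℝ)..L, pdx (pdx w) t x ^ 2 := by
    intro t
    have c0 := (hw.continuous.uncurry_left t).fun_pow 2
    have c1 := (hw1.continuous.uncurry_left t).fun_pow 2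
    have c2 := (hw2.continuous.uncurry_left t).fun_pow 2
    rw [intervalIntegral.integral_add ((c0.fun_add c1).intervalIntegrable _ _)
      (c2.intervalIntegrable _ _), intervalIntegral.integral_add (c0.intervalIntegrable _ _)
      (c1.intervalIntegrable _ _)]
  simp only [hsum]
  have hG := h.integral_higher_dissipation_le hL hT (C := M * C) fun t ht => by
    have := mul_le_mul_of_nonneg_left (hint t ht _ _ _ _ _ _ (h.profile ht)).1 hM0.le
    refine this.trans_eq ?_
    field_simp
  have key := integral_le_combination_add_boundary hT.le
    (a := fun t => t * ((∫ x in (0:ℝ)..L, w t x ^ 2) + (∫ x in (0:ℝ)..L, pdx w t x ^ 2) +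
        ∫ x in (0:ℝ)..L, pdx (pdx w) t x ^ 2))
    (p := fun t => ∫ x in (0:ℝ)..L, pdx w t x ^ 2)
    (q := fun t => t ^ 3 * ∫ x in (0:ℝ)..L, pdx (pdt w) t x ^ 2) (r := fun _ => 0)
    (by fun_prop) (by fun_prop) (by fun_prop) (by fun_prop) (continuous_const (y := (0 : ℝ)))
    (fun t => hasDerivAt_const t (0 : ℝ)) D (2 * (2 * M)⁻¹ ^ 2) 0 ?_
  · have h1 := h.integral_integral_pdx_sq_le hL hT
    have h2 := mul_le_mul_of_nonneg_left hG (by positivity : 0 ≤ 2 * (2 * M)⁻¹ ^ 2)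
    have h3 := mul_le_mul_of_nonneg_left h1
      (by positivity : 0 ≤ D + 2 * (2 * M)⁻¹ ^ 2 * (M * C))
    linarith
  · intro t ht
    have hW := (h.profile ht).integral_sq_le hL
    have hS := (hint t ht _ _ _ _ _ _ (h.profile ht)).2
    have hH : 0 ≤ ∫ x in (0:ℝ)..L, pdx w t x ^ 2 :=
      intervalIntegral.integral_nonneg hL.le fun _ _ => sq_nonneg _
    have h1 := mul_le_mul_of_nonneg_left hW ht.1.le
    have h2 : t * ((4 * L ^ 2 + 1) * ∫ x in (0:ℝ)..L, pdx w t x ^ 2) ≤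
        T * ((4 * L ^ 2 + 1) * ∫ x in (0:ℝ)..L, pdx w t x ^ 2) := by
      gcongr
      exact ht.2.le
    rw [hD]
    linarith
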